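/- Let ε > 0 and τ ∈ ℝ with τ > ε², and let k ≥ 1 be an integer with ε²·(πk + π/2)² < τ − ε². Then there exists t ∈ (πk, πk + π/2) satisfying ε²·(t² − t·sin 2t) = (τ − ε²)·sin²t; since sin t ≠ 0 on this interval, such t is a critical point of the phase φ(t) = −ε²t²·cot t + ε²t − tτ, i.e. a loop-return time t_k of the pilot-model dynamics. (This substantiates claims (16.1.27)–(16.1.28): there is a stationary point t_k ∼ πk in each tick, for roughly 2π⁻¹ε⁻¹√τ values of k in total.) -/

import Mathlib

/-- The pilot-model loop phase `φ(t) = −ε²t²·cot t + ε²t − tτ` of (16.1.23). -/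
noncomputable def loopPhase (ε τ : ℝ) (t : ℝ) : ℝ :=
  -(ε^2) * t^2 * (Real.cos t / Real.sin t) + ε^2 * t - t * τ

theorem hasDerivAt_loopPhase (ε τ : ℝ) {t : ℝ} (ht : Real.sin t ≠ 0) :
    HasDerivAt (loopPhase ε τ)
      ((ε^2 * (t^2 - t * Real.sin (2*t)) - (τ - ε^2) * (Real.sin t)^2) / (Real.sin t)^2) t := by
  have h := ((((hasDerivAt_id t).pow 2).const_mul (-(ε^2))).mul
    ((Real.hasDerivAt_cos t).div (Real.hasDerivAt_sin t) ht)).add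
    ((hasDerivAt_id t).const_mul (ε^2)) |>.sub ((hasDerivAt_id t).mul_const τ)
  refine h.congr_deriv ?_
  rw [Real.sin_two_mul]
  simp only [id, Pi.pow_apply, Pi.div_apply]
  field_simp
  norm_num
  linear_combination (ε^2 * t^2) * Real.sin_sq_add_cos_sq t

theorem sin_ne_zero_of_mem_Ioo_nat_mul_pi {k : ℕ} {t : ℝ}
    (ht : t ∈ Set.Ioo (Real.pi * k) (Real.pi * k + Real.pi/2)) : Real.sin t ≠ 0 := by
  intro h
  have hpos : 0 < Real.sin (t - k * Real.pi) :=
    Real.sin_pos_of_pos_of_lt_pi (by linarith [ht.1]) (by linarith [ht.2, Real.pi_pos])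
  rw [Real.sin_sub, h, Real.sin_nat_mul_pi] at hpos
  simp at hpos

/-- Claims (16.1.27)–(16.1.28): for each integer `k ≥ 1` with
`ε²(πk + π/2)² < τ − ε²` there is a return time `t_k ∈ (πk, πk + π/2)`, i.e. a
solution of (16.1.24), which (since `sin t ≠ 0` there) is a critical point of the
phase `φ`. -/
theorem loopPhase_stationary_point_exists (ε τ : ℝ) (hε : 0 < ε) (hτ : ε^2 < τ)
    (k : ℕ) (hk : 1 ≤ k)
    (hsmall : ε^2 * (Real.pi * k + Real.pi/2)^2 < τ - ε^2) :
    ∃ t ∈ Set.Ioo (Real.pi * k) (Real.pi * k + Real.pi/2),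
      ε^2 * (t^2 - t * Real.sin (2*t)) = (τ - ε^2) * (Real.sin t)^2 ∧
      Real.sin t ≠ 0 ∧
      deriv (loopPhase ε τ) t = 0 := by
  have hpi := Real.pi_pos
  have hk' : (0 : ℝ) < k := by exact_mod_cast hk
  have hsin : Real.sin (Real.pi * k) = 0 := by rw [mul_comm, Real.sin_nat_mul_pi]
  have hcos : Real.cos (Real.pi * k) ^ 2 = 1 := by
    linear_combination Real.sin_sq_add_cos_sq (Real.pi * k) - Real.sin (Real.pi * k) * hsin
  have hcont : ContinuousOn
      (fun t : ℝ => ε^2 * (t^2 - t * Real.sin (2*t)) - (τ - ε^2) * (Real.sin t)^2)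
      (Set.Icc (Real.pi * k) (Real.pi * k + Real.pi/2)) := by fun_prop
  have hzero : (0 : ℝ) ∈ Set.Ioo
      (ε^2 * ((Real.pi * k + Real.pi/2)^2 - (Real.pi * k + Real.pi/2) *
        Real.sin (2 * (Real.pi * k + Real.pi/2)))
        - (τ - ε^2) * (Real.sin (Real.pi * k + Real.pi/2))^2)
      (ε^2 * ((Real.pi * k)^2 - (Real.pi * k) * Real.sin (2 * (Real.pi * k)))
        - (τ - ε^2) * (Real.sin (Real.pi * k))^2) := by
    constructor
    · rw [Real.sin_two_mul, Real.cos_add_pi_div_two, Real.sin_add_pi_div_two, hsin, hcos]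
      linarith
    · rw [Real.sin_two_mul, hsin]
      ring_nf
      positivity
  obtain ⟨t, ht, hroot⟩ := intermediate_value_Ioo' (by linarith) hcont hzero
  have hne := sin_ne_zero_of_mem_Ioo_nat_mul_pi ht
  refine ⟨t, ht, sub_eq_zero.mp hroot, hne, ?_⟩
  rw [(hasDerivAt_loopPhase ε τ hne).deriv, div_eq_zero_iff]
  exact Or.inl hroot
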